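/- Let E be a Banach space, 1 ≤ p < ∞, and let K₁, K₂, … be a sequence of nonempty relatively p-compact subsets of E such that ∑_{j=1}^∞ m_p(K_j) < ∞. Then for any choice of x_j ∈ K_j the series ∑_{j=1}^∞ x_j converges absolutely, and the set K = {∑_{j=1}^∞ x_j : x_j ∈ K_j for all j} is relatively p-compact with m_p(K) ≤ ∑_{j=1}^∞ m_p(K_j). -/

import Mathlib

open scoped ENNReal NNReal Classical
open Filter Metric

noncomputable section

/-- Membership in the closed unit ball of `ℓ_q`, where `q` is the conjugate exponent of `p`
(`q = ∞`, i.e. bounded coefficients, when `p = 1`). -/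
def ConjUnitBall (p : ℝ) (α : ℕ → ℂ) : Prop :=
  if p = 1 then ∀ n, ‖α n‖ ≤ 1
  else (Summable fun n => ‖α n‖ ^ (p / (p - 1))) ∧ (∑' n, ‖α n‖ ^ (p / (p - 1))) ≤ 1

variable {E : Type*} [NormedAddCommGroup E] [NormedSpace ℂ E]

/-- The `p`-convex hull `p-co{x_n}` of a sequence `(x_n)`. -/
def pCo (p : ℝ) (x : ℕ → E) : Set E :=
  {y | ∃ α : ℕ → ℂ, ConjUnitBall p α ∧ HasSum (fun n => α n • x n) y}

/-- A set is relatively `p`-compact if it is contained in the `p`-convex hull of a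
`p`-summable sequence. -/
def IsRelPCompact (p : ℝ) (K : Set E) : Prop :=
  ∃ x : ℕ → E, (Summable fun n => ‖x n‖ ^ p) ∧ K ⊆ pCo p x

/-- The measure of `p`-compactness `m_p(K)`. -/
def mP (p : ℝ) (K : Set E) : ℝ :=
  sInf {r : ℝ | ∃ x : ℕ → E, (Summable fun n => ‖x n‖ ^ p) ∧ K ⊆ pCo p x ∧
    r = (∑' n, ‖x n‖ ^ p) ^ (1 / p)}

theorem summable_unpair_of_nonneg {f : ℕ → ℕ → ℝ} {b : ℕ → ℝ} (hf : ∀ i j, 0 ≤ f i j)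
    (hs : ∀ i, Summable (f i)) (hfb : ∀ i, ∑' j, f i j ≤ b i) (hb : Summable b) :
    (Summable fun n : ℕ => f n.unpair.1 n.unpair.2) ∧
      ∑' n : ℕ, f n.unpair.1 n.unpair.2 ≤ ∑' i, b i := by
  have hrow : Summable fun i => ∑' j, f i j :=
    Summable.of_nonneg_of_le (fun i => tsum_nonneg (hf i)) hfb hb
  have hprod : Summable fun q : ℕ × ℕ => f q.1 q.2 :=
    (summable_prod_of_nonneg fun q => hf q.1 q.2).2 ⟨hs, hrow⟩
  refine ⟨by simpa [Function.comp_def] using Nat.pairEquiv.symm.summable_iff.2 hprod, ?_⟩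
  calc ∑' n : ℕ, f n.unpair.1 n.unpair.2 = ∑' q : ℕ × ℕ, f q.1 q.2 := by
        simpa using Nat.pairEquiv.symm.tsum_eq fun q : ℕ × ℕ => f q.1 q.2
    _ = ∑' i, ∑' j, f i j := hprod.tsum_prod
    _ ≤ ∑' i, b i := hrow.tsum_le_tsum hfb hb

theorem ConjUnitBall.norm_le_one {α : ℕ → ℂ} (hα : ConjUnitBall 1 α) (n : ℕ) : ‖α n‖ ≤ 1 := by
  simp only [ConjUnitBall, if_true] at hα
  exact hα n

/-- Hölder's inequality against the closed unit ball of the conjugate sequence space. -/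
theorem ConjUnitBall.summable_norm_smul {p : ℝ} (hp : 1 ≤ p) {α : ℕ → ℂ}
    (hα : ConjUnitBall p α) {x : ℕ → E} (hx : Summable fun n => ‖x n‖ ^ p) :
    (Summable fun n => ‖α n • x n‖) ∧ ∑' n, ‖α n • x n‖ ≤ (∑' n, ‖x n‖ ^ p) ^ (1 / p) := by
  simp only [norm_smul]
  rcases hp.eq_or_lt with rfl | hp
  · simp only [Real.rpow_one, div_one] at hx ⊢
    have hle : ∀ n, ‖α n‖ * ‖x n‖ ≤ ‖x n‖ := fun n =>
      mul_le_of_le_one_left (norm_nonneg _) (hα.norm_le_one n)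
    have hs := Summable.of_nonneg_of_le (fun n => by positivity) hle hx
    exact ⟨hs, hs.tsum_le_tsum hle hx⟩
  · rw [ConjUnitBall, if_neg hp.ne'] at hα
    have hpq : p.HolderConjugate (p / (p - 1)) := .conjExponent hp
    obtain ⟨hs, hle⟩ := Real.summable_and_inner_le_Lp_mul_Lq_tsum_of_nonneg hpq.symm
      (fun n => norm_nonneg (α n)) (fun n => norm_nonneg (x n)) hα.1 hx
    refine ⟨hs, hle.trans (mul_le_of_le_one_left (by positivity) ?_)⟩
    exact Real.rpow_le_one (by positivity) hα.2 (one_div_nonneg.2 hpq.symm.nonneg)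

theorem norm_le_of_mem_pCo {p : ℝ} (hp : 1 ≤ p) {x : ℕ → E} (hx : Summable fun n => ‖x n‖ ^ p)
    {y : E} (hy : y ∈ pCo p x) : ‖y‖ ≤ (∑' n, ‖x n‖ ^ p) ^ (1 / p) := by
  obtain ⟨α, hα, hsum⟩ := hy
  obtain ⟨hs, hle⟩ := hα.summable_norm_smul hp hx
  exact hsum.tsum_eq ▸ (norm_tsum_le_tsum_norm hs).trans hle

theorem mP_le {p : ℝ} {K : Set E} {x : ℕ → E} (hx : Summable fun n => ‖x n‖ ^ p)
    (hK : K ⊆ pCo p x) : mP p K ≤ (∑' n, ‖x n‖ ^ p) ^ (1 / p) := by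
  refine csInf_le ⟨0, ?_⟩ ⟨x, hx, hK, rfl⟩
  rintro _ ⟨x, -, -, rfl⟩
  positivity

theorem mP_nonneg (p : ℝ) (K : Set E) : 0 ≤ mP p K := by
  refine Real.sInf_nonneg ?_
  rintro _ ⟨x, -, -, rfl⟩
  positivity

theorem IsRelPCompact.exists_lt {p r : ℝ} {K : Set E} (hK : IsRelPCompact p K)
    (hr : mP p K < r) : ∃ x : ℕ → E, (Summable fun n => ‖x n‖ ^ p) ∧ K ⊆ pCo p x ∧
      (∑' n, ‖x n‖ ^ p) ^ (1 / p) < r := by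
  obtain ⟨x, hx, hKx⟩ := hK
  rw [mP] at hr
  obtain ⟨_, ⟨x, hx, hKx, rfl⟩, hlt⟩ :=
    exists_lt_of_csInf_lt (by exact ⟨_, x, hx, hKx, rfl⟩) hr
  exact ⟨x, hx, hKx, hlt⟩

theorem IsRelPCompact.norm_le_mP {p : ℝ} (hp : 1 ≤ p) {K : Set E} (hK : IsRelPCompact p K)
    {y : E} (hy : y ∈ K) : ‖y‖ ≤ mP p K := by
  refine le_of_forall_gt fun r hr => ?_
  obtain ⟨x, hx, hKx, hlt⟩ := hK.exists_lt hr
  exact (norm_le_of_mem_pCo hp hx (hKx hy)).trans_lt hlt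

/-- Sums of points of the hulls `pCo p (x j)` lie in the hull of a single sequence, obtained by
concatenating the sequences `x j`, each rescaled according to the size `s j`. -/
theorem exists_pCo_of_hasSum [CompleteSpace E] {p : ℝ} (hp : 1 ≤ p) {s : ℕ → ℝ}
    (hs : ∀ j, 0 < s j) (hss : Summable s) {x : ℕ → ℕ → E}
    (hx : ∀ j, Summable fun n => ‖x j n‖ ^ p)
    (hxs : ∀ j, (∑' n, ‖x j n‖ ^ p) ^ (1 / p) ≤ s j) :
    ∃ z : ℕ → E, (Summable fun n => ‖z n‖ ^ p) ∧ (∑' n, ‖z n‖ ^ p) ^ (1 / p) ≤ ∑' j, s j ∧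
      {y | ∃ u : ℕ → E, (∀ j, u j ∈ pCo p (x j)) ∧ HasSum u y} ⊆ pCo p z := by
  have hp0 : 0 < p := by linarith
  set S := ∑' j, s j
  have hS : 0 < S := hss.tsum_pos (fun j => (hs j).le) 0 (hs 0)
  set w : ℕ → ℝ := fun j => (s j / S) ^ ((p - 1) / p)
  have hw : ∀ j, 0 < w j := fun j => Real.rpow_pos_of_pos (div_pos (hs j) hS) _
  have hwp : ∀ j, w j ^ p = (s j / S) ^ (p - 1) := fun j => by
    rw [← Real.rpow_mul (div_pos (hs j) hS).le, div_mul_cancel₀ _ hp0.ne']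
  have hxp : ∀ j, ∑' n, ‖x j n‖ ^ p ≤ s j ^ p := fun j => by
    have h := Real.rpow_le_rpow (by positivity) (hxs j) hp0.le
    rwa [← Real.rpow_mul (by positivity), one_div_mul_cancel hp0.ne', Real.rpow_one] at h
  set z : ℕ → ℕ → E := fun j n => ((w j : ℂ)⁻¹) • x j n
  have hz : ∀ j n, ‖z j n‖ ^ p = (w j ^ p)⁻¹ * ‖x j n‖ ^ p := fun j n => by
    rw [norm_smul, norm_inv, Complex.norm_of_nonneg (hw j).le,
      Real.mul_rpow (inv_nonneg.2 (hw j).le) (norm_nonneg _), Real.inv_rpow (hw j).le]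
  have hzb : ∀ j, ∑' n, ‖z j n‖ ^ p ≤ S ^ (p - 1) * s j := fun j => by
    simp only [hz, tsum_mul_left, hwp]
    calc ((s j / S) ^ (p - 1))⁻¹ * ∑' n, ‖x j n‖ ^ p
        ≤ ((s j / S) ^ (p - 1))⁻¹ * s j ^ p := by
          have := div_pos (hs j) hS
          gcongr
          exact hxp j
      _ = S ^ (p - 1) * s j := by
          have h1 : s j ^ p = s j ^ (p - 1) * s j := by
            rw [← Real.rpow_add_one (hs j).ne', sub_add_cancel]
          have h2 := Real.rpow_pos_of_pos (hs j) (p - 1)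
          rw [Real.div_rpow (hs j).le hS.le, h1]
          field_simp
  obtain ⟨hz1, hz2⟩ := summable_unpair_of_nonneg (f := fun j n => ‖z j n‖ ^ p)
    (fun _ _ => by positivity) (fun j => by simpa only [hz] using (hx j).mul_left _) hzb
    (hss.mul_left _)
  refine ⟨fun n => z n.unpair.1 n.unpair.2, hz1, ?_, ?_⟩
  · rw [tsum_mul_left, ← Real.rpow_add_one hS.ne', sub_add_cancel] at hz2
    have h := Real.rpow_le_rpow (by positivity) hz2 (one_div_nonneg.2 hp0.le)
    rwa [← Real.rpow_mul hS.le, mul_one_div_cancel hp0.ne', Real.rpow_one] at h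
  rintro y ⟨u, hu, huy⟩
  choose α hα hαu using hu
  refine ⟨fun n => (w n.unpair.1 : ℂ) * α n.unpair.1 n.unpair.2, ?_, ?_⟩
  · rcases hp.eq_or_lt with rfl | hp
    · simp only [ConjUnitBall, if_true]
      intro n
      have hw1 : w n.unpair.1 = 1 := by simp [w]
      simpa [hw1] using (hα n.unpair.1).norm_le_one n.unpair.2
    · simp only [ConjUnitBall, if_neg hp.ne'] at hα ⊢
      have hp1 : p - 1 ≠ 0 := by linarith
      have hwq : ∀ j, w j ^ (p / (p - 1)) = s j / S := fun j => by
        rw [← Real.rpow_mul (div_pos (hs j) hS).le, div_mul_div_cancel₀ hp0.ne',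
          div_self hp1, Real.rpow_one]
      have hβ : ∀ j n, ‖(w j : ℂ) * α j n‖ ^ (p / (p - 1)) =
          s j / S * ‖α j n‖ ^ (p / (p - 1)) := fun j n => by
        rw [norm_mul, Complex.norm_of_nonneg (hw j).le,
          Real.mul_rpow (hw j).le (norm_nonneg _), hwq]
      obtain ⟨h1, h2⟩ := summable_unpair_of_nonneg (b := fun j => s j / S)
        (f := fun j n => ‖(w j : ℂ) * α j n‖ ^ (p / (p - 1)))
        (fun _ _ => by positivity) (fun j => by simpa only [hβ] using (hα j).1.mul_left _)
        (fun j => by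
          simp only [hβ, tsum_mul_left]
          exact mul_le_of_le_one_right (div_pos (hs j) hS).le (hα j).2)
        (hss.div_const S)
      refine ⟨h1, h2.trans_eq ?_⟩
      rw [tsum_div_const, div_self hS.ne']
  · have hterm : ∀ j n, ((w j : ℂ) * α j n) • z j n = α j n • x j n := fun j n => by
      have : (w j : ℂ) ≠ 0 := Complex.ofReal_ne_zero.2 (hw j).ne'
      rw [smul_smul, mul_right_comm, mul_inv_cancel₀ this, one_mul]
    have hH := fun j => (hα j).summable_norm_smul hp (hx j)
    have hsum : Summable fun q : ℕ × ℕ => α q.1 q.2 • x q.1 q.2 := by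
      refine Summable.of_norm ((summable_prod_of_nonneg fun q => norm_nonneg _).2
        ⟨fun j => (hH j).1, ?_⟩)
      exact Summable.of_nonneg_of_le (fun j => tsum_nonneg fun n => norm_nonneg _)
        (fun j => (hH j).2.trans (hxs j)) hss
    have hy := (hsum.hasSum.prod_fiberwise hαu).unique huy
    simp only [hterm]
    have hprod := Nat.pairEquiv.symm.hasSum_iff.2 hsum.hasSum
    rw [hy] at hprod
    simpa [Function.comp_def] using hprod

/-- **Lemma 3.1.** Let `E` be a Banach space, `1 ≤ p < ∞`, and `K₁, K₂, …` a sequence of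
nonempty relatively `p`-compact subsets of `E` with `∑_j m_p(K_j) < ∞`.  Then for any choice
`x_j ∈ K_j` the series `∑_j x_j` converges absolutely, and the set
`K = {∑_j x_j : x_j ∈ K_j}` is relatively `p`-compact with `m_p(K) ≤ ∑_j m_p(K_j)`. -/
theorem statement4 [CompleteSpace E] (p : ℝ) (hp : 1 ≤ p)
    (K : ℕ → Set E) (hne : ∀ j, (K j).Nonempty)
    (hK : ∀ j, IsRelPCompact p (K j))
    (hsum : Summable fun j => mP p (K j)) :
    (∀ x : ℕ → E, (∀ j, x j ∈ K j) → Summable fun j => ‖x j‖) ∧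
    IsRelPCompact p {y : E | ∃ x : ℕ → E, (∀ j, x j ∈ K j) ∧ HasSum x y} ∧
    mP p {y : E | ∃ x : ℕ → E, (∀ j, x j ∈ K j) ∧ HasSum x y} ≤ ∑' j, mP p (K j) := by
  have hrel : ∀ ε > 0, ∃ z : ℕ → E, (Summable fun n => ‖z n‖ ^ p) ∧
      (∑' n, ‖z n‖ ^ p) ^ (1 / p) ≤ ∑' j, mP p (K j) + ε ∧
      {y : E | ∃ x : ℕ → E, (∀ j, x j ∈ K j) ∧ HasSum x y} ⊆ pCo p z := fun ε hε => by
    have hδ : ∀ j : ℕ, 0 < ε / 2 / 2 ^ j := fun j => by positivity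
    choose x hx hKx hlt using fun j => (hK j).exists_lt (lt_add_of_pos_right _ (hδ j))
    obtain ⟨z, hz, hle, hsub⟩ := exists_pCo_of_hasSum hp
      (fun j => add_pos_of_nonneg_of_pos (mP_nonneg p (K j)) (hδ j))
      (hsum.add (summable_geometric_two' ε)) hx fun j => (hlt j).le
    rw [hsum.tsum_add (summable_geometric_two' ε), tsum_geometric_two'] at hle
    refine ⟨z, hz, hle, fun y hy => ?_⟩
    obtain ⟨u, hu, huy⟩ := hy
    exact hsub ⟨u, fun j => hKx j (hu j), huy⟩
  refine ⟨fun x hx => ?_, ?_, ?_⟩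
  · exact Summable.of_nonneg_of_le (fun j => norm_nonneg _)
      (fun j => (hK j).norm_le_mP hp (hx j)) hsum
  · obtain ⟨z, hz, -, hsub⟩ := hrel 1 one_pos
    exact ⟨z, hz, hsub⟩
  · refine le_of_forall_pos_le_add fun ε hε => ?_
    obtain ⟨z, hz, hle, hsub⟩ := hrel ε hε
    exact (mP_le hz hsub).trans hle

end
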